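/- Let γ ≥ 2, p(s) = s^γ. For any 0 < a ≤ b there exists c > 0 such that for all r ∈ [a,b] and all ρ > 0: |ρ(p'(ρ) - p'(r)) - p''(r)(ρ - r)r| ≤ c·(P(ρ) - P(r) - P'(r)(ρ - r)), where P(ρ) = (ρ^γ - ρ)/(γ-1). -/

import Mathlib

/-- The graph of `x ↦ x ^ γ` lies above its tangent line at a positive point `r`. -/
theorem rpow_tangent_le {γ r ρ : ℝ} (hγ : 1 ≤ γ) (hr : 0 < r) (hρ : 0 ≤ ρ) :
    r ^ γ + γ * r ^ (γ - 1) * (ρ - r) ≤ ρ ^ γ := by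
  have hB := one_add_mul_self_le_rpow_one_add (s := ρ / r - 1)
    (by linarith [div_nonneg hρ hr.le]) hγ
  rw [add_sub_cancel, Real.div_rpow hρ hr.le, le_div_iff₀ (Real.rpow_pos_of_pos hr γ)] at hB
  refine le_of_eq_of_le ?_ hB
  rw [Real.rpow_sub_one hr.ne']
  field_simp

theorem stmt_11 (γ : ℝ) (hγ : 2 ≤ γ) (p P : ℝ → ℝ)
    (hp : ∀ s : ℝ, p s = s ^ γ)
    (hP : ∀ ρ : ℝ, P ρ = (ρ ^ γ - ρ) / (γ - 1))
    (a b : ℝ) (ha : 0 < a) (hab : a ≤ b) :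
    ∃ c : ℝ, 0 < c ∧ ∀ r ∈ Set.Icc a b, ∀ ρ : ℝ, 0 < ρ →
      |ρ * (deriv p ρ - deriv p r) - deriv (deriv p) r * (ρ - r) * r|
        ≤ c * (P ρ - P r - deriv P r * (ρ - r)) := by
  have hγ1 : 0 < γ - 1 := by linarith
  have hdp : deriv p = fun s => γ * s ^ (γ - 1) := by
    rw [funext hp]
    ext s
    exact (Real.hasDerivAt_rpow_const (Or.inr (by linarith))).deriv
  have hddp (s : ℝ) : deriv (deriv p) s = γ * ((γ - 1) * s ^ (γ - 1 - 1)) := by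
    rw [hdp]
    exact ((Real.hasDerivAt_rpow_const (Or.inr (by linarith))).const_mul γ).deriv
  have hdP (s : ℝ) : deriv P s = (γ * s ^ (γ - 1) - 1) / (γ - 1) := by
    rw [funext hP]
    exact (((Real.hasDerivAt_rpow_const (Or.inr (by linarith))).sub
      (hasDerivAt_id s)).div_const _).deriv
  refine ⟨γ * (γ - 1), by positivity, fun r hr ρ hρ => ?_⟩
  have hr0 : 0 < r := ha.trans_le hr.1
  have hE : 0 ≤ ρ ^ γ - r ^ γ - γ * r ^ (γ - 1) * (ρ - r) := by
    linarith [rpow_tangent_le (by linarith : 1 ≤ γ) hr0 hρ.le]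
  have hL : ρ * (deriv p ρ - deriv p r) - deriv (deriv p) r * (ρ - r) * r =
      γ * (ρ ^ γ - r ^ γ - γ * r ^ (γ - 1) * (ρ - r)) := by
    rw [hddp, hdp]
    simp only [Real.rpow_sub_one hr0.ne', Real.rpow_sub_one hρ.ne']
    field_simp
    ring
  rw [hL, abs_of_nonneg (by positivity), hdP, hP, hP]
  apply le_of_eq
  field_simp
  ring
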